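/- Let (V,ρ) be an anchored A-module and n ≥ 1. All the unit-insertion maps ι_p : Σ_V^{⊗_A (n−1)} → Σ_V^{⊗_A n} (1 ≤ p ≤ n) induce one and the same k-linear map j : Σ_V^{[n−1]} → Σ_V^{[n]}, and the map π : Σ_V^{[n]} → V^{⊗_A n} induced by π_V on each factor is a well-defined surjection whose kernel is exactly the image of j. In other words, the sequence Σ_V^{[n−1]} → Σ_V^{[n]} → V^{⊗_A n} → 0 is exact. -/

import Mathlib

universe u

section SigmaPowers

variable {k : Type u} [CommRing k]

/-- The right `A`-action on the Atiyah bimodule `Σ_V = A × V`: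
`(b,v)·a = (ba + ρ(v)(a), a•v)`. -/
def rA {A V : Type u} [CommRing A] [Algebra k A] [AddCommGroup V] [Module A V]
    (ρ : V →ₗ[A] Derivation k A A) (s : A × V) (a : A) : A × V :=
  (s.1 * a + ρ s.2 a, a • s.2)

/-- The left `A`-action on the Atiyah bimodule `Σ_V = A × V`: `a·(b,v) = (ab, a•v)`. -/
def lA {A V : Type u} [CommRing A] [AddCommGroup V] [Module A V]
    (a : A) (s : A × V) : A × V :=
  (a * s.1, a • s.2)

variable (T : ℕ → Type u) [∀ n, AddCommGroup (T n)] [∀ n, Module k (T n)]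
  (ins : ∀ n : ℕ, Fin (n + 1) → T n →ₗ[k] T (n + 1))

/-- The `k`-span of the differences `ι_p(x) − ι_q(x)` of unit insertions,
inside `Σ_V^{⊗(n+1)}`. -/
def relSub (n : ℕ) : Submodule k (T (n + 1)) :=
  Submodule.span k {y | ∃ (x : T n) (p q : Fin (n + 1)), y = ins n p x - ins n q x}

/-- `Σ_V^{[n]}`: the quotient of `Σ_V^{⊗ n}` by the span of the differences of unit
insertions (with `Σ_V^{[0]} = A`, the empty tensor product). -/
def QSig (A : Type u) : ℕ → Type u
  | 0 => A
  | n + 1 => T (n + 1) ⧸ relSub T ins n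

instance (A : Type u) [AddCommGroup A] : ∀ n, AddCommGroup (QSig T ins A n)
  | 0 => inferInstanceAs (AddCommGroup A)
  | n + 1 => inferInstanceAs (AddCommGroup (T (n + 1) ⧸ relSub T ins n))

instance (A : Type u) [AddCommGroup A] [Module k A] : ∀ n, Module k (QSig T ins A n)
  | 0 => inferInstanceAs (Module k A)
  | n + 1 => inferInstanceAs (Module k (T (n + 1) ⧸ relSub T ins n))

/-- The canonical projection `Σ_V^{⊗ n} → Σ_V^{[n]}` (at level `0`, the inverse of the
canonical identification `e0 : A ≅ Σ_V^{⊗ 0}`). -/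
def mkQSig {A : Type u} [AddCommGroup A] [Module k A] (e0 : A ≃ₗ[k] T 0) :
    ∀ n, T n → QSig T ins A n
  | 0 => fun x => e0.symm x
  | _n + 1 => fun x => Submodule.Quotient.mk x

end SigmaPowers

section Balanced

variable {k A V : Type u} [CommRing k] [CommRing A] [Algebra k A] [AddCommGroup V] [Module A V]

/-- A map out of tuples in `Σ_V` that is additive in each slot and balances the right action on
each slot against the left action on the next one. -/
structure IsBalancedMap (ρ : V →ₗ[A] Derivation k A A) {n : ℕ} {N : Type u} [AddCommGroup N]
    (f : (Fin n → A × V) → N) : Prop where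
  map_update_add : ∀ (s : Fin n → A × V) (i : Fin n) (x y : A × V),
    f (Function.update s i (x + y)) = f (Function.update s i x) + f (Function.update s i y)
  map_update_rA : ∀ (s : Fin n → A × V) (i j : Fin n), (i : ℕ) + 1 = (j : ℕ) → ∀ a : A,
    f (Function.update s i (rA ρ (s i) a)) = f (Function.update s j (lA a (s j)))

/-- A balanced map through which every balanced map factors uniquely. -/
structure IsUniversalBalanced (ρ : V →ₗ[A] Derivation k A A) {n : ℕ} {T : Type u}
    [AddCommGroup T] (t : (Fin n → A × V) → T) : Prop extends IsBalancedMap ρ t where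
  existsUnique_lift : ∀ (N : Type u) [AddCommGroup N] (f : (Fin n → A × V) → N),
    IsBalancedMap ρ f → ∃! F : T →+ N, ∀ s, F (t s) = f s

variable {ρ : V →ₗ[A] Derivation k A A} {n : ℕ} {N T : Type u} [AddCommGroup N] [AddCommGroup T]

theorem IsBalancedMap.comp {f : (Fin n → A × V) → T} (hf : IsBalancedMap ρ f) (F : T →+ N) :
    IsBalancedMap ρ (fun s => F (f s)) where
  map_update_add s i x y := by rw [hf.map_update_add, map_add]
  map_update_rA s i j hij a := by rw [hf.map_update_rA s i j hij]

theorem IsUniversalBalanced.addHom_ext {t : (Fin n → A × V) → T} (ht : IsUniversalBalanced ρ t)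
    {F G : T →+ N} (h : ∀ s, F (t s) = G (t s)) : F = G :=
  (ht.existsUnique_lift N _ (ht.toIsBalancedMap.comp G)).unique h fun _ => rfl

/-- Killing the tuples with a unit slot forces killing the tuples with a slot in `A × 0`, since
the coefficient of that slot can be moved to a neighbouring one. -/
theorem IsBalancedMap.eq_zero_of_snd_eq_zero {f : (Fin (n + 2) → A × V) → N}
    (hf : IsBalancedMap ρ f)
    (h1 : ∀ (p : Fin (n + 2)) (s : Fin (n + 1) → A × V), f (p.insertNth ((1 : A), (0 : V)) s) = 0)
    (s : Fin (n + 2) → A × V) (i : Fin (n + 2)) (hs : (s i).2 = 0) : f s = 0 := by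
  have h1' : ∀ s : Fin (n + 2) → A × V, s i = (1, 0) → f s = 0 := fun s h => by
    rw [← Fin.insertNth_self_removeNth i s, h, h1]
  set s₁ := Function.update s i ((1 : A), (0 : V)) with hs₁
  have hsi : s₁ i = (1, 0) := by simp [hs₁]
  have hss : s = Function.update s₁ i ((s i).1, 0) := by
    rw [hs₁, Function.update_idem, ← hs, Prod.mk.eta, Function.update_eq_self]
  rcases Fin.eq_zero_or_eq_succ i with rfl | ⟨j, rfl⟩
  · have h := hf.map_update_rA s₁ 0 1 rfl (s 0).1
    have hr : rA ρ (s₁ 0) (s 0).1 = ((s 0).1, 0) := by simp [hsi, rA]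
    rw [hr, ← hss] at h
    rw [h]
    exact h1' _ (by simp [hsi])
  · have h := hf.map_update_rA s₁ j.castSucc j.succ (by simp) (s j.succ).1
    have hl : lA (s j.succ).1 (s₁ j.succ) = ((s j.succ).1, 0) := by simp [hsi, lA]
    rw [hl, ← hss] at h
    rw [← h]
    exact h1' _ (by rw [Function.update_of_ne (Fin.castSucc_lt_succ).ne', hsi])

end Balanced

section Lift

variable {A V N : Type*} [CommRing A] [AddCommGroup V] [Module A V] [AddCommGroup N]

/-- A multiadditive map in which scalars move between adjacent slots factors through the
`A`-linear tensor power, without any `A`-module structure on the target. -/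
theorem PiTensorProduct.exists_addHom_of_adjacent {n : ℕ} (g : (Fin (n + 1) → V) → N)
    (g_add : ∀ (v : Fin (n + 1) → V) (i : Fin (n + 1)) (x y : V),
      g (Function.update v i (x + y)) = g (Function.update v i x) + g (Function.update v i y))
    (g_adj : ∀ (v : Fin (n + 1) → V) (i j : Fin (n + 1)), (i : ℕ) + 1 = (j : ℕ) → ∀ a : A,
      g (Function.update v i (a • v i)) = g (Function.update v j (a • v j))) :
    ∃ G : PiTensorProduct A (fun _ : Fin (n + 1) => V) →+ N,
      ∀ v, G (PiTensorProduct.tprod A v) = g v := by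
  have g_move : ∀ (v : Fin (n + 1) → V) (a : A) (i : Fin (n + 1)),
      g (Function.update v i (a • v i)) = g (Function.update v 0 (a • v 0)) := by
    intro v a i
    induction i using Fin.induction with
    | zero => rfl
    | succ i ih => rw [← ih, g_adj v i.castSucc i.succ (by simp)]
  have g_zero : ∀ (v : Fin (n + 1) → V) (i : Fin (n + 1)), v i = 0 → g v = 0 := by
    intro v i hv
    have h := g_add v i 0 0
    rwa [add_zero, ← hv, Function.update_eq_self, left_eq_add] at h
  refine ⟨PiTensorProduct.liftAddHom
    (fun p : A × (Fin (n + 1) → V) => g (Function.update p.2 0 (p.1 • p.2 0)))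
    ?_ ?_ ?_ ?_ ?_, ?_⟩
  · intro r f i hf
    dsimp only
    rw [← g_move f r i]
    exact g_zero _ i (by simp [hf])
  · intro f
    exact g_zero _ 0 (by simp)
  · intro inst r f i x y
    obtain rfl : inst = instDecidableEqFin _ := Subsingleton.elim _ _
    dsimp only
    rw [← g_move _ r i, ← g_move _ r i, ← g_move _ r i]
    simp only [Function.update_self, Function.update_idem, smul_add, g_add]
  · intro r r' f
    dsimp only
    rw [add_smul, g_add]
  · intro inst r f i r'
    obtain rfl : inst = instDecidableEqFin _ := Subsingleton.elim _ _
    dsimp only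
    rw [← g_move _ r i, Function.update_self, Function.update_idem, smul_smul, g_move,
      mul_comm]
  · intro v
    have h : g (Function.update v 0 ((1 : A) • v 0)) = g v := by
      rw [one_smul, Function.update_eq_self]
    exact h

end Lift

section Projection

variable {k A V : Type u} [CommRing k] [CommRing A] [Algebra k A] [AddCommGroup V] [Module A V]
  {ρ : V →ₗ[A] Derivation k A A} {n : ℕ}

theorem PiTensorProduct.smul_tprod_update [Module k V] [IsScalarTower k A V] (s : Fin n → V)
    (i : Fin n) (c : k) :
    PiTensorProduct.tprod A (Function.update s i (c • s i)) = c • PiTensorProduct.tprod A s := by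
  rw [← algebraMap_smul A c (s i), MultilinearMap.map_update_smul, Function.update_eq_self,
    algebraMap_smul]

theorem update_snd {A V : Type*} (s : Fin n → A × V) (i : Fin n) (x : A × V) :
    (fun l => (Function.update s i x l).2) = Function.update (fun l => (s l).2) i x.2 := by
  ext l
  rcases eq_or_ne l i with rfl | h
  · simp
  · simp [h]

theorem isBalancedMap_tprod_snd (ρ : V →ₗ[A] Derivation k A A) :
    IsBalancedMap ρ fun s : Fin n → A × V => PiTensorProduct.tprod A fun i => (s i).2 where
  map_update_add s i x y := by
    simp only [update_snd, Prod.snd_add, MultilinearMap.map_update_add]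
  map_update_rA s i j _ a := by
    simp only [update_snd, rA, lA]
    rw [PiTensorProduct.smul_tprod_update (fun l => (s l).2) i a,
      PiTensorProduct.smul_tprod_update (fun l => (s l).2) j a]

/-- The projection `T → V^{⊗ (n + 1)}` induced by `π_V` on each factor. -/
theorem IsUniversalBalanced.exists_projection [Module k V] [IsScalarTower k A V]
    {T : Type u} [AddCommGroup T] [Module k T]
    {t : (Fin (n + 1) → A × V) → T} (ht : IsUniversalBalanced ρ t)
    (t_smul : ∀ (s : Fin (n + 1) → A × V) (i : Fin (n + 1)) (c : k),
      c • t s = t (Function.update s i (c • s i))) :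
    ∃ P : T →ₗ[k] PiTensorProduct A (fun _ : Fin (n + 1) => V),
      ∀ s, P (t s) = PiTensorProduct.tprod A fun i => (s i).2 := by
  obtain ⟨P, hP, -⟩ := ht.existsUnique_lift _ _ (isBalancedMap_tprod_snd ρ)
  refine ⟨{ P with map_smul' := fun c x => ?_ }, hP⟩
  have h : P.comp (DistribSMul.toAddMonoidHom T c) =
      (DistribSMul.toAddMonoidHom _ c).comp P := by
    refine ht.addHom_ext fun s => ?_
    simp only [AddMonoidHom.comp_apply, DistribSMul.toAddMonoidHom_apply, t_smul s 0 c, hP,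
      update_snd]
    exact PiTensorProduct.smul_tprod_update (fun l => (s l).2) 0 c
  exact DFunLike.congr_fun h x

theorem PiTensorProduct.surjective_of_tprod {T : Type*} [AddCommGroup T]
    (P : T →+ PiTensorProduct A (fun _ : Fin (n + 1) => V))
    (hP : ∀ v, ∃ x, P x = PiTensorProduct.tprod A v) : Function.Surjective P := by
  intro z
  induction z using PiTensorProduct.induction_on with
  | smul_tprod r v =>
    obtain ⟨x, hx⟩ := hP (Function.update v 0 (r • v 0))
    exact ⟨x, by rw [hx, PiTensorProduct.smul_tprod_update]⟩
  | add y z hy hz =>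
    obtain ⟨y, rfl⟩ := hy
    obtain ⟨z, rfl⟩ := hz
    exact ⟨y + z, map_add _ _ _⟩

/-- A balanced map that kills every tuple with a slot in `A × 0` factors through
`V^{⊗ (n + 1)}`. -/
theorem IsBalancedMap.exists_addHom_tprod {N : Type u} [AddCommGroup N]
    {f : (Fin (n + 1) → A × V) → N} (hf : IsBalancedMap ρ f)
    (h0 : ∀ (s : Fin (n + 1) → A × V) (i : Fin (n + 1)), (s i).2 = 0 → f s = 0) :
    ∃ G : PiTensorProduct A (fun _ : Fin (n + 1) => V) →+ N,
      ∀ s, G (PiTensorProduct.tprod A fun i => (s i).2) = f s := by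
  have f_fst : ∀ (s : Fin (n + 1) → A × V) (i : Fin (n + 1)) (x y : A × V), x.2 = y.2 →
      f (Function.update s i x) = f (Function.update s i y) := by
    intro s i x y hxy
    have h := hf.map_update_add s i (x - y) y
    rwa [sub_add_cancel, h0 (Function.update s i (x - y)) i (by simp [hxy]), zero_add] at h
  have f_snd : ∀ s s' : Fin (n + 1) → A × V, (∀ i, (s i).2 = (s' i).2) → f s = f s' := by
    intro s s' hs
    have key : ∀ I : Finset (Fin (n + 1)), f (I.piecewise s' s) = f s := by
      intro I
      induction I using Finset.induction_on with
      | empty => simp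
      | insert i I _ ih =>
        rw [Finset.piecewise_insert, f_fst _ i (s' i) (I.piecewise s' s i),
          Function.update_eq_self, ih]
        by_cases hi : i ∈ I <;> simp [hi, hs]
    simpa using (key Finset.univ).symm
  have update_zero_fst : ∀ (v : Fin (n + 1) → V) (i : Fin (n + 1)) (x : V),
      (fun l => ((0 : A), Function.update v i x l)) =
        Function.update (fun l => ((0 : A), v l)) i (0, x) := by
    intro v i x
    ext l <;> rcases eq_or_ne l i with rfl | h <;> simp [*]
  obtain ⟨G, hG⟩ := PiTensorProduct.exists_addHom_of_adjacent (A := A)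
    (fun v : Fin (n + 1) → V => f fun i => ((0 : A), v i))
    (fun v i x y => by
      simp only [update_zero_fst]
      rw [← hf.map_update_add, Prod.mk_add_mk, add_zero])
    (fun v i j hij a => by
      simp only [update_zero_fst]
      have h := hf.map_update_rA (fun l => ((0 : A), v l)) i j hij a
      exact (f_fst _ i (0, a • v i) (rA ρ (0, v i) a) rfl).trans
        (h.trans (f_fst _ j _ (0, a • v j) rfl)))
  exact ⟨G, fun s => by rw [hG]; exact f_snd _ _ fun _ => rfl⟩

end Projection

section Quotient

variable {k A : Type u} [CommRing k] {T : ℕ → Type u} [∀ n, AddCommGroup (T n)]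
  [∀ n, Module k (T n)] {ins : ∀ n : ℕ, Fin (n + 1) → T n →ₗ[k] T (n + 1)}

theorem mkQSig_surjective [AddCommGroup A] [Module k A] (e0 : A ≃ₗ[k] T 0) (n : ℕ) :
    Function.Surjective (mkQSig T ins e0 n) := by
  cases n with
  | zero => exact e0.symm.surjective
  | succ n => exact Submodule.Quotient.mk_surjective _

theorem mkQ_ins_eq (n : ℕ) (p q : Fin (n + 1)) (x : T n) :
    (relSub T ins n).mkQ (ins n p x) = (relSub T ins n).mkQ (ins n q x) :=
  (Submodule.Quotient.eq _).2 (Submodule.subset_span ⟨x, p, q, rfl⟩)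

/-- If inserting a unit at the front commutes with the other insertions, up to a shift, then the
unit insertions descend to one and the same map of the quotients. -/
theorem exists_QSig_map [AddCommGroup A] [Module k A] (e0 : A ≃ₗ[k] T 0)
    (hcomm : ∀ (n : ℕ) (p : Fin (n + 2)) (x : T (n + 1)),
      ins (n + 2) 0 (ins (n + 1) p x) = ins (n + 2) p.succ (ins (n + 1) 0 x)) (n : ℕ) :
    ∃ j : QSig T ins A n →ₗ[k] QSig T ins A (n + 1), ∀ (p : Fin (n + 1)) (x : T n),
      j (mkQSig T ins e0 n x) = mkQSig T ins e0 (n + 1) (ins n p x) := by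
  match n with
  | 0 =>
    refine ⟨(relSub T ins 0).mkQ ∘ₗ ins 0 0 ∘ₗ e0.toLinearMap, fun p x => ?_⟩
    obtain rfl := Fin.fin_one_eq_zero p
    exact congrArg (fun y => (relSub T ins 0).mkQ (ins 0 0 y)) (e0.apply_symm_apply x)
  | n + 1 =>
    have hle : relSub T ins n ≤ LinearMap.ker ((relSub T ins (n + 1)).mkQ ∘ₗ ins (n + 1) 0) := by
      refine Submodule.span_le.2 ?_
      rintro _ ⟨x, p, q, rfl⟩
      rw [SetLike.mem_coe, LinearMap.mem_ker, map_sub, sub_eq_zero]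
      match n with
      | 0 => rw [Fin.fin_one_eq_zero p, Fin.fin_one_eq_zero q]
      | n + 1 =>
        simp only [LinearMap.comp_apply, hcomm]
        exact mkQ_ins_eq _ _ _ _
    exact ⟨(relSub T ins n).liftQ _ hle, fun p x => mkQ_ins_eq (n + 1) 0 p x⟩

end Quotient

/-- Let `(V,ρ)` be an anchored `A`-module and `n ≥ 1` (below, `n+1`).  Let `T m` (with
the multiadditive balanced maps `tt m`, the unit-insertion maps `ins`, and `e0 : A ≅ T 0`)
be a realization of the tensor powers `Σ_V^{⊗ m}` of the Atiyah bimodule, and let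
`Σ_V^{[m]} = QSig` be the quotient of `Σ_V^{⊗ m}` by the span of the differences
`ι_p(x) − ι_q(x)` of unit insertions.  Then all the unit-insertion maps
`ι_p : Σ_V^{⊗ n} → Σ_V^{⊗(n+1)}` induce one and the same `k`-linear map
`j : Σ_V^{[n]} → Σ_V^{[n+1]}`, and the map `π : Σ_V^{[n+1]} → V^{⊗(n+1)}` induced by
`π_V` on each factor is a well-defined surjection whose kernel is exactly the image of
`j`: the sequence `Σ_V^{[n]} → Σ_V^{[n+1]} → V^{⊗(n+1)} → 0` is exact. -/
theorem stmt_15 (k A V : Type u) [Field k] [CharZero k] [CommRing A] [Algebra k A]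
    [AddCommGroup V] [Module k V] [Module A V] [IsScalarTower k A V]
    (ρ : V →ₗ[A] Derivation k A A)
    (T : ℕ → Type u) [∀ n, AddCommGroup (T n)] [∀ n, Module k (T n)]
    (tt : ∀ n : ℕ, (Fin n → A × V) → T n)
    (ins : ∀ n : ℕ, Fin (n + 1) → T n →ₗ[k] T (n + 1))
    (e0 : A ≃ₗ[k] T 0)
    -- `tt n` is additive in each slot
    (tt_add : ∀ (n : ℕ) (s : Fin n → A × V) (i : Fin n) (x y : A × V),
      tt n (Function.update s i (x + y)) =
        tt n (Function.update s i x) + tt n (Function.update s i y))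
    -- the `k`-action is the action on any single slot
    (tt_smul : ∀ (n : ℕ) (s : Fin n → A × V) (i : Fin n) (c : k),
      c • tt n s = tt n (Function.update s i (c • s i)))
    -- `tt n` balances the right action of adjacent slots against the left action
    (tt_bal : ∀ (n : ℕ) (s : Fin n → A × V) (i j : Fin n), (i : ℕ) + 1 = (j : ℕ) →
      ∀ a : A, tt n (Function.update s i (rA ρ (s i) a)) =
        tt n (Function.update s j (lA a (s j))))
    -- `T n` is universal among multiadditive balanced maps (for `n ≥ 1`)
    (tt_univ : ∀ n : ℕ, 1 ≤ n → ∀ (N : Type u) [AddCommGroup N]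
      (f : (Fin n → A × V) → N),
      (∀ (s : Fin n → A × V) (i : Fin n) (x y : A × V),
        f (Function.update s i (x + y)) =
          f (Function.update s i x) + f (Function.update s i y)) →
      (∀ (s : Fin n → A × V) (i j : Fin n), (i : ℕ) + 1 = (j : ℕ) →
        ∀ a : A, f (Function.update s i (rA ρ (s i) a)) =
          f (Function.update s j (lA a (s j)))) →
      ∃! F : T n →+ N, ∀ s, F (tt n s) = f s)
    -- `ins n p` inserts the unit `1 = (1,0)` of `Σ_V` in the `p`-th slot
    (hins : ∀ (n : ℕ), 1 ≤ n → ∀ (p : Fin (n + 1)) (s : Fin n → A × V),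
      ins n p (tt n s) = tt (n + 1) (p.insertNth ((1 : A), (0 : V)) s))
    (hins0 : ∀ (p : Fin 1) (a : A),
      ins 0 p (e0 a) = tt 1 (fun _ => (a, (0 : V)))) :
    ∀ n : ℕ,
      ∃ (j : QSig T ins A n →ₗ[k] QSig T ins A (n + 1))
        (π : QSig T ins A (n + 1) →ₗ[k] PiTensorProduct A (fun _ : Fin (n + 1) => V)),
        -- all the insertions `ι_p` induce one and the same map `j` …
        (∀ (p : Fin (n + 1)) (x : T n),
          j (mkQSig T ins e0 n x) = mkQSig T ins e0 (n + 1) (ins n p x)) ∧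
        -- … and `j` is unique with this property
        (∀ j' : QSig T ins A n →ₗ[k] QSig T ins A (n + 1),
          (∀ (p : Fin (n + 1)) (x : T n),
            j' (mkQSig T ins e0 n x) = mkQSig T ins e0 (n + 1) (ins n p x)) → j' = j) ∧
        -- `π` is the well-defined map induced by `π_V` on each factor …
        (∀ s : Fin (n + 1) → A × V,
          π (mkQSig T ins e0 (n + 1) (tt (n + 1) s)) =
            PiTensorProduct.tprod A (fun i => (s i).2)) ∧
        -- … and `π` is unique with this property
        (∀ π' : QSig T ins A (n + 1) →ₗ[k] PiTensorProduct A (fun _ : Fin (n + 1) => V),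
          (∀ s : Fin (n + 1) → A × V,
            π' (mkQSig T ins e0 (n + 1) (tt (n + 1) s)) =
              PiTensorProduct.tprod A (fun i => (s i).2)) → π' = π) ∧
        -- `π` is surjective and its kernel is exactly the image of `j`
        Function.Surjective π ∧
        (∀ y : QSig T ins A (n + 1), π y = 0 ↔ y ∈ Set.range j) := by
  have huniv : ∀ n, IsUniversalBalanced ρ (tt (n + 1)) := fun n =>
    { map_update_add := tt_add (n + 1)
      map_update_rA := tt_bal (n + 1)
      existsUnique_lift := fun N _ f hf =>
        tt_univ (n + 1) n.succ_pos N f hf.map_update_add hf.map_update_rA }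
  have hcomm : ∀ (n : ℕ) (p : Fin (n + 2)) (x : T (n + 1)),
      ins (n + 2) 0 (ins (n + 1) p x) = ins (n + 2) p.succ (ins (n + 1) 0 x) := by
    intro n p
    refine DFunLike.congr_fun ((huniv n).addHom_ext
      (F := (ins (n + 2) 0 ∘ₗ ins (n + 1) p).toAddMonoidHom)
      (G := (ins (n + 2) p.succ ∘ₗ ins (n + 1) 0).toAddMonoidHom) fun s => ?_)
    simp only [LinearMap.toAddMonoidHom_coe, LinearMap.comp_apply]
    rw [hins _ (by lia), hins _ (by lia), hins _ (by lia), hins _ (by lia),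
      Fin.insertNth_zero', Fin.insertNth_zero', Fin.insertNth_succ_cons]
  have hvanish : ∀ (n : ℕ) (N : Type u) [AddCommGroup N] (F : T (n + 1) →+ N),
      (∀ (p : Fin (n + 1)) (x : T n), F (ins n p x) = 0) →
      ∀ (s : Fin (n + 1) → A × V) (i : Fin (n + 1)), (s i).2 = 0 → F (tt (n + 1) s) = 0 := by
    intro n N _ F hF
    match n with
    | 0 =>
      intro s i hs
      have h : s = fun _ => ((s i).1, (0 : V)) := by
        funext l
        rw [Fin.fin_one_eq_zero l, Fin.fin_one_eq_zero i, ← hs, Fin.fin_one_eq_zero i]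
      rw [h, ← hins0 0]
      exact hF 0 _
    | n + 1 =>
      refine ((huniv (n + 1)).toIsBalancedMap.comp F).eq_zero_of_snd_eq_zero fun p s => ?_
      rw [← hins _ (by lia)]
      exact hF p _
  intro n
  obtain ⟨j, hj⟩ := exists_QSig_map e0 hcomm n
  obtain ⟨P, hP⟩ := (huniv n).exists_projection (tt_smul (n + 1))
  have hPins : ∀ (p : Fin (n + 1)) (x : T n), P (ins n p x) = 0 := by
    intro p
    match n with
    | 0 =>
      intro x
      obtain ⟨a, rfl⟩ := e0.surjective x
      rw [hins0, hP]
      exact MultilinearMap.map_coord_zero _ 0 rfl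
    | n + 1 =>
      refine DFunLike.congr_fun ((huniv n).addHom_ext
        (F := (P ∘ₗ ins (n + 1) p).toAddMonoidHom) (G := 0) fun s => ?_)
      simp only [LinearMap.toAddMonoidHom_coe, LinearMap.comp_apply, AddMonoidHom.zero_apply]
      rw [hins _ (by lia), hP]
      exact MultilinearMap.map_coord_zero _ p (by simp)
  let π : QSig T ins A (n + 1) →ₗ[k] PiTensorProduct A (fun _ : Fin (n + 1) => V) :=
    (relSub T ins n).liftQ P (Submodule.span_le.2 (by
      rintro _ ⟨x, p, q, rfl⟩
      rw [SetLike.mem_coe, LinearMap.mem_ker, map_sub, hPins, hPins, sub_zero]))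
  have hπP : ∀ x, π (mkQSig T ins e0 (n + 1) x) = P x := fun _ => rfl
  refine ⟨j, π, hj, fun j' hj' => ?_, fun s => (hπP _).trans (hP s), fun π' hπ' => ?_, ?_,
    fun y => ⟨fun hy => ?_, ?_⟩⟩
  · ext y
    obtain ⟨x, rfl⟩ := mkQSig_surjective e0 n y
    rw [hj' 0, hj 0]
  · ext y
    obtain ⟨x, rfl⟩ := mkQSig_surjective e0 (n + 1) y
    have h := (huniv n).addHom_ext
      (F := (π' ∘ₗ (relSub T ins n).mkQ : T (n + 1) →ₗ[k] _).toAddMonoidHom)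
      (G := P.toAddMonoidHom) fun s => (hπ' s).trans (hP s).symm
    exact DFunLike.congr_fun h x
  · refine PiTensorProduct.surjective_of_tprod π.toAddMonoidHom fun v => ?_
    exact ⟨mkQSig T ins e0 (n + 1) (tt (n + 1) fun i => (0, v i)), (hπP _).trans (hP _)⟩
  · obtain ⟨x, rfl⟩ := mkQSig_surjective e0 (n + 1) y
    let q : T (n + 1) →ₗ[k] QSig T ins A (n + 1) ⧸ LinearMap.range j :=
      (LinearMap.range j).mkQ ∘ₗ (relSub T ins n).mkQ
    have hq : ∀ x, q x = (LinearMap.range j).mkQ (mkQSig T ins e0 (n + 1) x) := fun _ => rfl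
    have hqins : ∀ (p : Fin (n + 1)) (x : T n), q (ins n p x) = 0 := fun p x => by
      rw [hq, ← hj, Submodule.mkQ_apply, Submodule.Quotient.mk_eq_zero]
      exact LinearMap.mem_range_self j _
    obtain ⟨G, hG⟩ := ((huniv n).toIsBalancedMap.comp q.toAddMonoidHom).exists_addHom_tprod
      (hvanish n _ q.toAddMonoidHom hqins)
    have hGP : G.comp P.toAddMonoidHom = q.toAddMonoidHom := (huniv n).addHom_ext fun s => by
      rw [← hG, AddMonoidHom.comp_apply, LinearMap.toAddMonoidHom_coe, hP]
    have hqx : q x = 0 := by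
      have h := DFunLike.congr_fun hGP x
      rw [AddMonoidHom.comp_apply, LinearMap.toAddMonoidHom_coe, ← hπP, hy, map_zero] at h
      exact h.symm
    exact (Submodule.Quotient.mk_eq_zero _).1 ((hq x).symm.trans hqx)
  · rintro ⟨z, rfl⟩
    obtain ⟨x, rfl⟩ := mkQSig_surjective e0 n z
    rw [hj 0, hπP, hPins]
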